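/- arXiv:2011.08962 — 7 statements merged into one kernel-verified Lean document; each statement's English description precedes it below -/
import Mathlib

section
/- Let (V, ω) be a symplectic vector space of dimension 2n with n ≥ 1, let (τ, ν) be a polarization of V, and let L be a Lagrangian subspace transverse to ν. Then for every coisotropic subspace W ⊆ V with ν ⊆ W, the reductions [τ]^W and [ν]^W are transverse Lagrangian subspaces of the reduction [V]^W, and [L]^W is a Lagrangian subspace of [V]^W transverse to [ν]^W. Moreover, the following are equivalent: (i) L ≻_ν τ; (ii) [L]^W ≻_{[ν]^W} [τ]^W for every coisotropic subspace W with ν ⊆ W and dim W > n; (iii) [L]^W ≻_{[ν]^W} [τ]^W for every coisotropic subspace W with ν ⊆ W and dim W = n + 1. -/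
open Module

variable {V : Type*} [AddCommGroup V] [Module ℝ V]

/-- The `ω`-orthogonal complement of a subspace `W`:
`W^⊥ = {v ∈ V : ω(v, x) = 0 for all x ∈ W}`. -/
def SympOrtho (ω : V →ₗ[ℝ] V →ₗ[ℝ] ℝ) (W : Submodule ℝ V) : Submodule ℝ V :=
  ⨅ x ∈ W, LinearMap.ker (ω.flip x)

/-- A symplectic form: a nondegenerate alternating bilinear form. -/
def IsSymplectic (ω : V →ₗ[ℝ] V →ₗ[ℝ] ℝ) : Prop :=
  (∀ v : V, (∀ w : V, ω v w = 0) → v = 0) ∧ ∀ v : V, ω v v = 0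

/-- A subspace is Lagrangian if it equals its `ω`-orthogonal complement. -/
def IsLagrangian (ω : V →ₗ[ℝ] V →ₗ[ℝ] ℝ) (L : Submodule ℝ V) : Prop :=
  SympOrtho ω L = L

/-- `PosRel ω X Y Z` says `X ≻_Z Y` (with respect to the polarization `(Y, Z)`):
for every nonzero `x ∈ Y` and every `m ∈ Z` with `x + m ∈ X` (such an `m` exists and
is unique since `V = X ⊕ Z`), one has `ω(m, x) > 0`; i.e. the quadratic form
`X^{(Y,Z)}` is positive definite. -/
def PosRel (ω : V →ₗ[ℝ] V →ₗ[ℝ] ℝ) (X Y Z : Submodule ℝ V) : Prop :=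
  ∀ x ∈ Y, x ≠ 0 → ∀ m ∈ Z, x + m ∈ X → 0 < ω m x

/-- `NegRel ω X Y Z` says `X ≺_Z Y`: the quadratic form `X^{(Y,Z)}` is negative
definite. -/
def NegRel (ω : V →ₗ[ℝ] V →ₗ[ℝ] ℝ) (X Y Z : Submodule ℝ V) : Prop :=
  ∀ x ∈ Y, x ≠ 0 → ∀ m ∈ Z, x + m ∈ X → ω m x < 0

/-- The preimage in `W` of the symplectic reduction `[S]^W = ((S ∩ W) + W^⊥)/W^⊥`:
the subspace `(S ⊓ W) + W^⊥` of `V`. -/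
def RedSub (ω : V →ₗ[ℝ] V →ₗ[ℝ] ℝ) (W S : Submodule ℝ V) : Submodule ℝ V :=
  (S ⊓ W) ⊔ SympOrtho ω W

/-- `[S]^W` is a Lagrangian subspace of the reduction `[V]^W = W/W^⊥`: the preimage of
`[S]^W` in `W` coincides with the preimage of its ω̄-orthogonal complement, namely
`W ⊓ (RedSub ω W S)^⊥`. -/
def RedLagrangian (ω : V →ₗ[ℝ] V →ₗ[ℝ] ℝ) (W S : Submodule ℝ V) : Prop :=
  RedSub ω W S = W ⊓ SympOrtho ω (RedSub ω W S)

/-- `[S]^W` and `[T]^W` are transverse in the reduction `[V]^W`: the intersection of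
their preimages in `W` is exactly `W^⊥` (the kernel of the projection `W → W/W^⊥`). -/
def RedTransverse (ω : V →ₗ[ℝ] V →ₗ[ℝ] ℝ) (W S T : Submodule ℝ V) : Prop :=
  RedSub ω W S ⊓ RedSub ω W T = SympOrtho ω W

/-- `RedPosRel ω W X Y Z` says `[X]^W ≻_{[Z]^W} [Y]^W` in the reduction `[V]^W`:
for every `x` representing a nonzero element of `[Y]^W` and every `m` representing an
element of `[Z]^W` with `x̄ + m̄ ∈ [X]^W`, one has `ω̄(m̄, x̄) = ω(m, x) > 0`. -/
def RedPosRel (ω : V →ₗ[ℝ] V →ₗ[ℝ] ℝ) (W X Y Z : Submodule ℝ V) : Prop :=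
  ∀ x ∈ RedSub ω W Y, x ∉ SympOrtho ω W →
    ∀ m ∈ RedSub ω W Z, x + m ∈ RedSub ω W X → 0 < ω m x

theorem IsSymplectic.isRefl {ω : V →ₗ[ℝ] V →ₗ[ℝ] ℝ} (hω : IsSymplectic ω) : ω.IsRefl :=
  LinearMap.IsAlt.isRefl hω.2

theorem IsSymplectic.nondegenerate {ω : V →ₗ[ℝ] V →ₗ[ℝ] ℝ} (hω : IsSymplectic ω) :
    ω.Nondegenerate :=
  hω.isRefl.nondegenerate_iff_separatingLeft.mpr hω.1

theorem mem_sympOrtho {ω : V →ₗ[ℝ] V →ₗ[ℝ] ℝ} {W : Submodule ℝ V} {v : V} :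
    v ∈ SympOrtho ω W ↔ ∀ x ∈ W, ω v x = 0 := by
  simp [SympOrtho]

theorem IsSymplectic.sympOrtho_eq_orthogonal {ω : V →ₗ[ℝ] V →ₗ[ℝ] ℝ} (hω : IsSymplectic ω)
    (W : Submodule ℝ V) : SympOrtho ω W = LinearMap.BilinForm.orthogonal ω W := by
  ext v
  rw [mem_sympOrtho, LinearMap.BilinForm.mem_orthogonal_iff]
  exact forall₂_congr fun x _ => ⟨hω.isRefl v x, hω.isRefl x v⟩

theorem sympOrtho_anti {ω : V →ₗ[ℝ] V →ₗ[ℝ] ℝ} {W W' : Submodule ℝ V} (h : W ≤ W') :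
    SympOrtho ω W' ≤ SympOrtho ω W := fun _ hv =>
  mem_sympOrtho.mpr fun x hx => mem_sympOrtho.mp hv x (h hx)

theorem sympOrtho_sup (ω : V →ₗ[ℝ] V →ₗ[ℝ] ℝ) (A B : Submodule ℝ V) :
    SympOrtho ω (A ⊔ B) = SympOrtho ω A ⊓ SympOrtho ω B := by
  refine le_antisymm (le_inf (sympOrtho_anti le_sup_left) (sympOrtho_anti le_sup_right)) ?_
  rintro v ⟨hA, hB⟩
  refine mem_sympOrtho.mpr fun x hx => ?_
  obtain ⟨a, ha, b, hb, rfl⟩ := Submodule.mem_sup.mp hx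
  rw [map_add, mem_sympOrtho.mp hA a ha, mem_sympOrtho.mp hB b hb, add_zero]

theorem IsSymplectic.sympOrtho_sympOrtho [FiniteDimensional ℝ V] {ω : V →ₗ[ℝ] V →ₗ[ℝ] ℝ}
    (hω : IsSymplectic ω) (W : Submodule ℝ V) : SympOrtho ω (SympOrtho ω W) = W := by
  rw [hω.sympOrtho_eq_orthogonal, hω.sympOrtho_eq_orthogonal]
  exact LinearMap.BilinForm.orthogonal_orthogonal hω.nondegenerate hω.isRefl W

theorem IsSymplectic.sympOrtho_inf [FiniteDimensional ℝ V] {ω : V →ₗ[ℝ] V →ₗ[ℝ] ℝ}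
    (hω : IsSymplectic ω) (A B : Submodule ℝ V) :
    SympOrtho ω (A ⊓ B) = SympOrtho ω A ⊔ SympOrtho ω B := by
  rw [← hω.sympOrtho_sympOrtho (SympOrtho ω A ⊔ SympOrtho ω B), sympOrtho_sup,
    hω.sympOrtho_sympOrtho, hω.sympOrtho_sympOrtho]

theorem IsLagrangian.finrank_add_finrank [FiniteDimensional ℝ V] {ω : V →ₗ[ℝ] V →ₗ[ℝ] ℝ}
    (hω : IsSymplectic ω) {L : Submodule ℝ V} (hL : IsLagrangian ω L) :
    finrank ℝ L + finrank ℝ L = finrank ℝ V := by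
  have h := LinearMap.BilinForm.finrank_orthogonal hω.nondegenerate L
  rw [← hω.sympOrtho_eq_orthogonal, hL] at h
  have := L.finrank_le
  lia

/-- The reduction of a Lagrangian subspace along a coisotropic subspace is Lagrangian. -/
theorem IsLagrangian.redLagrangian [FiniteDimensional ℝ V] {ω : V →ₗ[ℝ] V →ₗ[ℝ] ℝ}
    (hω : IsSymplectic ω) {L W : Submodule ℝ V} (hL : IsLagrangian ω L)
    (hW : SympOrtho ω W ≤ W) : RedLagrangian ω W L := by
  unfold RedLagrangian RedSub
  rw [sympOrtho_sup, hω.sympOrtho_inf, hω.sympOrtho_sympOrtho, hL, inf_comm L,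
    inf_sup_assoc_of_le L hW, inf_comm (L ⊔ _), inf_left_idem]

theorem IsLagrangian.sympOrtho_le {ω : V →ₗ[ℝ] V →ₗ[ℝ] ℝ} {ν W : Submodule ℝ V}
    (hν : IsLagrangian ω ν) (hνW : ν ≤ W) : SympOrtho ω W ≤ ν :=
  (sympOrtho_anti hνW).trans hν.le

theorem IsLagrangian.redSub_eq {ω : V →ₗ[ℝ] V →ₗ[ℝ] ℝ} {ν W : Submodule ℝ V}
    (hν : IsLagrangian ω ν) (hνW : ν ≤ W) : RedSub ω W ν = ν := by
  rw [RedSub, inf_eq_left.mpr hνW, sup_eq_left.mpr (hν.sympOrtho_le hνW)]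

theorem IsLagrangian.redTransverse {ω : V →ₗ[ℝ] V →ₗ[ℝ] ℝ} {L ν W : Submodule ℝ V}
    (hν : IsLagrangian ω ν) (hνW : ν ≤ W) (hLν : L ⊓ ν = ⊥) : RedTransverse ω W L ν := by
  rw [RedTransverse, hν.redSub_eq hνW, RedSub, sup_comm,
    sup_inf_assoc_of_le _ (hν.sympOrtho_le hνW), inf_right_comm, hLν, bot_inf_eq, sup_bot_eq]

/-- Positivity passes to reductions along subspaces containing `ν`. -/
theorem PosRel.redPosRel {ω : V →ₗ[ℝ] V →ₗ[ℝ] ℝ} {L τ ν W : Submodule ℝ V}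
    (h : PosRel ω L τ ν) (hω : IsSymplectic ω) (hν : IsLagrangian ω ν) (hνW : ν ≤ W) :
    RedPosRel ω W L τ ν := by
  intro x hx hxW m hm hxm
  rw [hν.redSub_eq hνW] at hm
  obtain ⟨t, ⟨htτ, htW⟩, p, hp, rfl⟩ := Submodule.mem_sup.mp hx
  obtain ⟨l, ⟨hlL, -⟩, q, hq, hlq⟩ := Submodule.mem_sup.mp hxm
  have ht : t ≠ 0 := by
    rintro rfl
    exact hxW (by simpa using hp)
  have hP := hν.sympOrtho_le hνW
  have hl : t + (m + p - q) = l := by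
    rw [eq_sub_of_add_eq hlq]
    abel
  have hpos := h t htτ ht (m + p - q) (ν.sub_mem (ν.add_mem hm (hP hp)) (hP hq)) (hl ▸ hlL)
  have hmp : ω m p = 0 := hω.isRefl p m (mem_sympOrtho.mp hp m (hνW hm))
  simpa [mem_sympOrtho.mp hp t htW, mem_sympOrtho.mp hq t htW, hmp] using hpos

theorem finrank_sup_span_singleton_of_notMem [FiniteDimensional ℝ V] {ν : Submodule ℝ V} {x : V}
    (hx : x ∉ ν) : finrank ℝ (ν ⊔ Submodule.span ℝ {x} : Submodule ℝ V) = finrank ℝ ν + 1 := by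
  have hx0 : x ≠ 0 := fun h => hx (h ▸ ν.zero_mem)
  have h := Submodule.finrank_sup_add_finrank_inf_eq ν (Submodule.span ℝ {x})
  rw [((Submodule.disjoint_span_singleton' hx0).mpr hx).eq_bot, finrank_bot, add_zero,
    finrank_span_singleton hx0] at h
  exact h

/-- Positivity can be tested on reductions along the subspaces `ν ⊔ span {x}`. -/
theorem posRel_of_forall_redPosRel [FiniteDimensional ℝ V] {ω : V →ₗ[ℝ] V →ₗ[ℝ] ℝ}
    {L τ ν : Submodule ℝ V} (hν : IsLagrangian ω ν) (hτν : τ ⊓ ν = ⊥)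
    (h : ∀ W : Submodule ℝ V, SympOrtho ω W ≤ W → ν ≤ W →
      finrank ℝ W = finrank ℝ ν + 1 → RedPosRel ω W L τ ν) : PosRel ω L τ ν := by
  intro x hx hx0 m hm hxm
  have hxν : x ∉ ν := fun hxν => hx0 (by simpa [hτν] using Submodule.mem_inf.mpr ⟨hx, hxν⟩)
  set W := ν ⊔ Submodule.span ℝ {x}
  have hνW : ν ≤ W := le_sup_left
  have hP := hν.sympOrtho_le hνW
  have hxW : x ∈ W := le_sup_right (a := ν) (Submodule.mem_span_singleton_self x)
  refine h W (hP.trans hνW) hνW (finrank_sup_span_singleton_of_notMem hxν) x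
    (Submodule.mem_sup_left ⟨hx, hxW⟩) (fun hxP => hxν (hP hxP)) m
    (Submodule.mem_sup_left ⟨hm, hνW hm⟩)
    (Submodule.mem_sup_left ⟨hxm, W.add_mem hxW (hνW hm)⟩)

/-- Let (V, ω) be a symplectic vector space of dimension 2n (n ≥ 1), (τ, ν) a
polarization of V and L a Lagrangian subspace transverse to ν. Then for every
coisotropic subspace W ⊇ ν, the reductions [τ]^W and [ν]^W are transverse Lagrangian
subspaces of [V]^W and [L]^W is a Lagrangian subspace of [V]^W transverse to [ν]^W.
Moreover the following are equivalent: (i) L ≻_ν τ; (ii) [L]^W ≻_{[ν]^W} [τ]^W for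
every coisotropic W ⊇ ν with dim W > n; (iii) [L]^W ≻_{[ν]^W} [τ]^W for every
coisotropic W ⊇ ν with dim W = n + 1. -/
theorem lagrangian_pos_iff_reductions [FiniteDimensional ℝ V]
    (n : ℕ) (hn : 1 ≤ n)
    (ω : V →ₗ[ℝ] V →ₗ[ℝ] ℝ) (hω : IsSymplectic ω)
    (hdim : Module.finrank ℝ V = 2 * n)
    (τ ν L : Submodule ℝ V)
    (hτ : IsLagrangian ω τ) (hν : IsLagrangian ω ν) (hτν : τ ⊓ ν = ⊥)
    (hL : IsLagrangian ω L) (hLν : L ⊓ ν = ⊥) :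
    (∀ W : Submodule ℝ V, SympOrtho ω W ≤ W → ν ≤ W →
        RedLagrangian ω W τ ∧ RedLagrangian ω W ν ∧ RedTransverse ω W τ ν ∧
        RedLagrangian ω W L ∧ RedTransverse ω W L ν) ∧
    (PosRel ω L τ ν ↔
      ∀ W : Submodule ℝ V, SympOrtho ω W ≤ W → ν ≤ W →
        n < Module.finrank ℝ W → RedPosRel ω W L τ ν) ∧
    (PosRel ω L τ ν ↔
      ∀ W : Submodule ℝ V, SympOrtho ω W ≤ W → ν ≤ W →
        Module.finrank ℝ W = n + 1 → RedPosRel ω W L τ ν) := by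
  have hdimν : finrank ℝ ν = n := by
    have := hν.finrank_add_finrank hω
    lia
  have hpos : (∀ W : Submodule ℝ V, SympOrtho ω W ≤ W → ν ≤ W →
      finrank ℝ W = n + 1 → RedPosRel ω W L τ ν) → PosRel ω L τ ν := fun h =>
    posRel_of_forall_redPosRel hν hτν (hdimν.symm ▸ h)
  refine ⟨fun W hW hνW => ⟨hτ.redLagrangian hω hW, hν.redLagrangian hω hW,
    hν.redTransverse hνW hτν, hL.redLagrangian hω hW, hν.redTransverse hνW hLν⟩,
    ⟨fun h W _ hνW _ => h.redPosRel hω hν hνW,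
      fun h => hpos fun W hW hνW hdimW => h W hW hνW (by lia)⟩,
    ⟨fun h W _ hνW _ => h.redPosRel hω hν hνW, hpos⟩⟩
end

section
/- Let (V, ω) be a symplectic vector space, (τ, ν) a polarization of V, and K, L Lagrangian subspaces each transverse to ν. If K ≻_ν L (taken with respect to the polarization (L, ν)) and L ≻_ν τ, then K ≻_ν τ. -/
open Module

variable {V : Type*} [AddCommGroup V] [Module ℝ V]

theorem IsSymplectic.surjective [FiniteDimensional ℝ V] {ω : V →ₗ[ℝ] V →ₗ[ℝ] ℝ}
    (hω : IsSymplectic ω) : Function.Surjective ω := by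
  refine (LinearMap.injective_iff_surjective_of_finrank_eq_finrank
    (Subspace.dual_finrank_eq (K := ℝ) (V := V)).symm).1 ?_
  refine (injective_iff_map_eq_zero ω).2 fun v hv => hω.1 v fun w => ?_
  rw [hv, LinearMap.zero_apply]

/-- Transverse Lagrangian subspaces span the whole space. -/
theorem IsLagrangian.sup_eq_top [FiniteDimensional ℝ V] {ω : V →ₗ[ℝ] V →ₗ[ℝ] ℝ}
    (hω : IsSymplectic ω) {L M : Submodule ℝ V} (hL : IsLagrangian ω L)
    (hM : IsLagrangian ω M) (h : L ⊓ M = ⊥) : L ⊔ M = ⊤ := by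
  by_contra hne
  obtain ⟨f, hf, hle⟩ := Submodule.exists_le_ker_of_lt_top _ (lt_top_iff_ne_top.2 hne)
  obtain ⟨v, rfl⟩ := hω.surjective f
  have hvL : v ∈ L := hL ▸ mem_sympOrtho.2 fun x hx => hle (Submodule.mem_sup_left hx)
  have hvM : v ∈ M := hM ▸ mem_sympOrtho.2 fun x hx => hle (Submodule.mem_sup_right hx)
  have hv : v ∈ L ⊓ M := ⟨hvL, hvM⟩
  rw [h, Submodule.mem_bot] at hv
  exact hf (by rw [hv, map_zero])

/-- **Transitivity.** Let (V, ω) be a symplectic vector space, (τ, ν) a polarization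
and K, L Lagrangian subspaces each transverse to ν. If K ≻_ν L (with respect to the
polarization (L, ν)) and L ≻_ν τ, then K ≻_ν τ. -/
theorem lagrangian_pos_trans [FiniteDimensional ℝ V]
    (ω : V →ₗ[ℝ] V →ₗ[ℝ] ℝ) (hω : IsSymplectic ω)
    (τ ν K L : Submodule ℝ V)
    (hτ : IsLagrangian ω τ) (hν : IsLagrangian ω ν)
    (hK : IsLagrangian ω K) (hL : IsLagrangian ω L)
    (hτν : τ ⊓ ν = ⊥) (hKν : K ⊓ ν = ⊥) (hLν : L ⊓ ν = ⊥)
    (hKL : PosRel ω K L ν) (hLτ : PosRel ω L τ ν) :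
    PosRel ω K τ ν := by
  intro x hx hx0 m hm hxm
  have hx_top : x ∈ L ⊔ ν := hL.sup_eq_top hω hν hLν ▸ Submodule.mem_top
  obtain ⟨y, hy, n, hn, rfl⟩ := Submodule.mem_sup.1 hx_top
  have hy0 : y ≠ 0 := by
    rintro rfl
    rw [zero_add] at hx hx0
    have hmem : n ∈ τ ⊓ ν := ⟨hx, hn⟩
    rw [hτν, Submodule.mem_bot] at hmem
    exact hx0 hmem
  have h₁ := hLτ (y + n) hx hx0 (-n) (ν.neg_mem hn) (by simpa using hy)
  have h₂ := hKL y hy hy0 (n + m) (ν.add_mem hn hm) (by rwa [← add_assoc])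
  have hmn : ω m n = 0 := mem_sympOrtho.1 (hν.symm ▸ hm) n hn
  have hnn : ω n n = 0 := hω.2 n
  simp only [map_add, map_neg, LinearMap.add_apply, LinearMap.neg_apply] at h₁ h₂ ⊢
  linarith
end

section
/- Let L1, L2, L3 be pairwise transverse Lagrangian subspaces of a symplectic vector space (V, ω), and let σ be a permutation of {1, 2, 3}. If σ is even, then L1 ≻_{L3} L2 holds if and only if L_{σ(1)} ≻_{L_{σ(3)}} L_{σ(2)} holds; if σ is odd, then L1 ≻_{L3} L2 holds if and only if L_{σ(1)} ≺_{L_{σ(3)}} L_{σ(2)} holds. (Here, for Lagrangians X, Y, Z, the relations X ≻_Z Y and X ≺_Z Y are taken with respect to the polarization (Y, Z).) -/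
open Module

variable {V : Type*} [AddCommGroup V] [Module ℝ V]

theorem PosRel.negRel_swap {ω : V →ₗ[ℝ] V →ₗ[ℝ] ℝ} (hω : ω.IsAlt) {X Y Z : Submodule ℝ V}
    (hXZ : X ⊓ Z = ⊥) (h : PosRel ω X Y Z) : NegRel ω X Z Y := by
  intro z hz hz0 y hy hX
  have hy0 : y ≠ 0 := by
    rintro rfl
    rw [add_zero] at hX
    exact hz0 ((Submodule.mem_bot ℝ).1 (hXZ ▸ Submodule.mem_inf.2 ⟨hX, hz⟩))
  have hpos := h y hy hy0 z hz (by rwa [add_comm])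
  rw [← hω.neg y z] at hpos
  linarith

theorem NegRel.posRel_swap {ω : V →ₗ[ℝ] V →ₗ[ℝ] ℝ} (hω : ω.IsAlt) {X Y Z : Submodule ℝ V}
    (hXZ : X ⊓ Z = ⊥) (h : NegRel ω X Y Z) : PosRel ω X Z Y := by
  intro z hz hz0 y hy hX
  have hy0 : y ≠ 0 := by
    rintro rfl
    rw [add_zero] at hX
    exact hz0 ((Submodule.mem_bot ℝ).1 (hXZ ▸ Submodule.mem_inf.2 ⟨hX, hz⟩))
  have hneg := h y hy hy0 z hz (by rwa [add_comm])
  rw [← hω.neg y z] at hneg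
  linarith

theorem PosRel.rotate {ω : V →ₗ[ℝ] V →ₗ[ℝ] ℝ} (hω : ω.IsAlt) {X Y Z : Submodule ℝ V}
    (hXZ : X ⊓ Z = ⊥) (h : PosRel ω X Y Z) : PosRel ω Y Z X := by
  intro z hz hz0 x hx hY
  have hy0 : z + x ≠ 0 := by
    intro h0
    have hzX : z ∈ X := by
      rw [eq_neg_of_add_eq_zero_left h0]
      exact X.neg_mem hx
    exact hz0 ((Submodule.mem_bot ℝ).1 (hXZ ▸ Submodule.mem_inf.2 ⟨hzX, hz⟩))
  have hpos := h (z + x) hY hy0 (-z) (Z.neg_mem hz) (by simpa using hx)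
  simpa [hω.self_eq_zero z, hω.neg z x] using hpos

/-- **Cyclic symmetry.** Let L1, L2, L3 be pairwise transverse Lagrangian subspaces of
a symplectic vector space (V, ω) and σ a permutation of {1,2,3} (here indexed by
Fin 3). If σ is even then L1 ≻_{L3} L2 iff L_{σ(1)} ≻_{L_{σ(3)}} L_{σ(2)}; if σ is odd
then L1 ≻_{L3} L2 iff L_{σ(1)} ≺_{L_{σ(3)}} L_{σ(2)}. For Lagrangians X, Y, Z, the
relations X ≻_Z Y and X ≺_Z Y are taken with respect to the polarization (Y, Z). -/
theorem lagrangian_pos_perm [FiniteDimensional ℝ V]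
    (ω : V →ₗ[ℝ] V →ₗ[ℝ] ℝ) (hω : IsSymplectic ω)
    (L : Fin 3 → Submodule ℝ V)
    (hLag : ∀ i, IsLagrangian ω (L i))
    (htrans : ∀ i j, i ≠ j → L i ⊓ L j = ⊥)
    (σ : Equiv.Perm (Fin 3)) :
    (Equiv.Perm.sign σ = 1 →
      (PosRel ω (L 0) (L 1) (L 2) ↔ PosRel ω (L (σ 0)) (L (σ 1)) (L (σ 2)))) ∧
    (Equiv.Perm.sign σ = -1 →
      (PosRel ω (L 0) (L 1) (L 2) ↔ NegRel ω (L (σ 0)) (L (σ 1)) (L (σ 2)))) := by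
  have hA : ω.IsAlt := hω.2
  have rot {i j k : Fin 3} (hij : i ≠ j) (hjk : j ≠ k) (hik : i ≠ k) :
      PosRel ω (L i) (L j) (L k) ↔ PosRel ω (L j) (L k) (L i) :=
    ⟨fun h => h.rotate hA (htrans i k hik), fun h =>
      (h.rotate hA (htrans j i hij.symm)).rotate hA (htrans k j hjk.symm)⟩
  have swap {i j k : Fin 3} (hij : i ≠ j) (hik : i ≠ k) :
      PosRel ω (L i) (L j) (L k) ↔ NegRel ω (L i) (L k) (L j) :=
    ⟨fun h => h.negRel_swap hA (htrans i k hik), fun h => h.posRel_swap hA (htrans i j hij)⟩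
  have rot₀ := rot (i := 0) (j := 1) (k := 2) (by decide) (by decide) (by decide)
  have rot₁ := rot (i := 1) (j := 2) (k := 0) (by decide) (by decide) (by decide)
  have swap₀ := swap (i := 0) (j := 1) (k := 2) (by decide) (by decide)
  have swap₁ := swap (i := 1) (j := 2) (k := 0) (by decide) (by decide)
  have swap₂ := swap (i := 2) (j := 0) (k := 1) (by decide) (by decide)
  have even_cases : ∀ τ : Equiv.Perm (Fin 3), Equiv.Perm.sign τ = 1 →
      (τ 0 = 0 ∧ τ 1 = 1 ∧ τ 2 = 2) ∨ (τ 0 = 1 ∧ τ 1 = 2 ∧ τ 2 = 0) ∨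
        (τ 0 = 2 ∧ τ 1 = 0 ∧ τ 2 = 1) := by decide
  have odd_cases : ∀ τ : Equiv.Perm (Fin 3), Equiv.Perm.sign τ = -1 →
      (τ 0 = 0 ∧ τ 1 = 2 ∧ τ 2 = 1) ∨ (τ 0 = 1 ∧ τ 1 = 0 ∧ τ 2 = 2) ∨
        (τ 0 = 2 ∧ τ 1 = 1 ∧ τ 2 = 0) := by decide
  constructor
  · intro hσ
    obtain ⟨h₀, h₁, h₂⟩ | ⟨h₀, h₁, h₂⟩ | ⟨h₀, h₁, h₂⟩ := even_cases σ hσ <;> rw [h₀, h₁, h₂]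
    · exact rot₀
    · exact rot₀.trans rot₁
  · intro hσ
    obtain ⟨h₀, h₁, h₂⟩ | ⟨h₀, h₁, h₂⟩ | ⟨h₀, h₁, h₂⟩ := odd_cases σ hσ <;> rw [h₀, h₁, h₂]
    · exact swap₀
    · exact rot₀.trans swap₁
    · exact (rot₀.trans rot₁).trans swap₂
end

section
/- Let (V, ω) be a symplectic vector space and let L1, L2, L3, L4 be Lagrangian subspaces with L1, L2, L3 each transverse to L4. Assume L3 ≻_{L4} L2 (with respect to the polarization (L2, L4)) and L2 ≻_{L4} L1 (with respect to (L1, L4)). Then: (a) L1 and L2 are each transverse to L3, and L2 ≻_{L3} L1 (with respect to (L1, L3)); (b) if additionally L is a Lagrangian subspace transverse to L3 with L ≻_{L3} L2 (with respect to (L2, L3)), then L is transverse to L4 and L ≻_{L4} L1 (with respect to (L1, L4)). -/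
open Module

variable {V : Type*} [AddCommGroup V] [Module ℝ V]

theorem IsLagrangian.mem_iff {ω : V →ₗ[ℝ] V →ₗ[ℝ] ℝ} {L : Submodule ℝ V}
    (hL : IsLagrangian ω L) {v : V} : v ∈ L ↔ ∀ x ∈ L, ω v x = 0 := by
  conv_lhs => rw [← hL]
  simp [SympOrtho, Submodule.mem_iInf]

/-- Transverse Lagrangian subspaces span the whole space. -/
theorem IsLagrangian.exists_add_eq [FiniteDimensional ℝ V] {ω : V →ₗ[ℝ] V →ₗ[ℝ] ℝ}
    (hω : IsSymplectic ω) {A B : Submodule ℝ V} (hA : IsLagrangian ω A)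
    (hB : IsLagrangian ω B) (hAB : A ⊓ B = ⊥) (v : V) :
    ∃ a ∈ A, ∃ b ∈ B, a + b = v := by
  suffices h : A ⊔ B = ⊤ from Submodule.mem_sup.1 (h ▸ Submodule.mem_top)
  by_contra h
  obtain ⟨f, hf, hle⟩ := Submodule.exists_le_ker_of_lt_top _ (lt_top_iff_ne_top.2 h)
  have hinj : Function.Injective ω := by
    rw [injective_iff_map_eq_zero]
    intro w hw
    exact hω.1 w fun x => by simp [hw]
  obtain ⟨w, rfl⟩ := (LinearMap.injective_iff_surjective_of_finrank_eq_finrank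
    (Subspace.dual_finrank_eq (K := ℝ) (V := V)).symm).1 hinj f
  have hw : w ∈ A ⊓ B :=
    ⟨hA.mem_iff.2 fun x hx => hle (Submodule.mem_sup_left hx),
      hB.mem_iff.2 fun x hx => hle (Submodule.mem_sup_right hx)⟩
  rw [hAB, Submodule.mem_bot] at hw
  exact hf (by simp [hw])

theorem PosRel.nonneg {ω : V →ₗ[ℝ] V →ₗ[ℝ] ℝ} {X Y Z : Submodule ℝ V}
    (h : PosRel ω X Y Z) {x m : V} (hx : x ∈ Y) (hm : m ∈ Z) (hxm : x + m ∈ X) :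
    0 ≤ ω m x := by
  rcases eq_or_ne x 0 with rfl | h0
  · simp
  · exact (h x hx h0 m hm hxm).le

theorem PosRel.eq_zero {ω : V →ₗ[ℝ] V →ₗ[ℝ] ℝ} {X Y Z : Submodule ℝ V}
    (h : PosRel ω X Y Z) {x m : V} (hx : x ∈ Y) (hm : m ∈ Z) (hxm : x + m ∈ X)
    (hle : ω m x ≤ 0) : x = 0 := by
  by_contra h0
  exact (h x hx h0 m hm hxm).not_ge hle

/-- Let L1, L2, L3, L4 be Lagrangian subspaces with L1, L2, L3 each transverse to L4.
Assume L3 ≻_{L4} L2 (w.r.t. (L2, L4)) and L2 ≻_{L4} L1 (w.r.t. (L1, L4)). Then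
(a) L1, L2 are each transverse to L3 and L2 ≻_{L3} L1 (w.r.t. (L1, L3));
(b) if L is a Lagrangian transverse to L3 with L ≻_{L3} L2 (w.r.t. (L2, L3)), then L
is transverse to L4 and L ≻_{L4} L1 (w.r.t. (L1, L4)). -/
theorem lagrangian_pos_chain [FiniteDimensional ℝ V]
    (ω : V →ₗ[ℝ] V →ₗ[ℝ] ℝ) (hω : IsSymplectic ω)
    (L₁ L₂ L₃ L₄ : Submodule ℝ V)
    (hL₁ : IsLagrangian ω L₁) (hL₂ : IsLagrangian ω L₂)
    (hL₃ : IsLagrangian ω L₃) (hL₄ : IsLagrangian ω L₄)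
    (h14 : L₁ ⊓ L₄ = ⊥) (h24 : L₂ ⊓ L₄ = ⊥) (h34 : L₃ ⊓ L₄ = ⊥)
    (h32 : PosRel ω L₃ L₂ L₄) (h21 : PosRel ω L₂ L₁ L₄) :
    (L₁ ⊓ L₃ = ⊥ ∧ L₂ ⊓ L₃ = ⊥ ∧ PosRel ω L₂ L₁ L₃) ∧
    (∀ L : Submodule ℝ V, IsLagrangian ω L → L ⊓ L₃ = ⊥ → PosRel ω L L₂ L₃ →
      L ⊓ L₄ = ⊥ ∧ PosRel ω L L₁ L₄) := by
  have ortho {L : Submodule ℝ V} (hL : IsLagrangian ω L) {a b : V} (ha : a ∈ L)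
      (hb : b ∈ L) : ω a b = 0 := hL.mem_iff.1 ha b hb
  have dis {A B : Submodule ℝ V} (h : A ⊓ B = ⊥) {a : V} (ha : a ∈ A) (hb : a ∈ B) :
      a = 0 := (Submodule.mem_bot ℝ).1 (h ▸ Submodule.mem_inf.2 ⟨ha, hb⟩)
  have h23 : L₂ ⊓ L₃ = ⊥ := by
    refine (Submodule.eq_bot_iff _).2 fun v hv => ?_
    exact h32.eq_zero (m := 0) hv.1 L₄.zero_mem (by simpa using hv.2) (by simp)
  refine ⟨⟨?_, h23, ?_⟩, fun L hL hL3 hpos => ?_⟩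
  · refine (Submodule.eq_bot_iff _).2 fun v hv => ?_
    obtain ⟨y, hy, n, hn, hyn⟩ := hL₂.exists_add_eq hω hL₄ h24 v
    have hvy : v + -n = y := by rw [← hyn]; abel
    have p1 := h32.nonneg hy hn (hyn ▸ hv.2)
    refine h21.eq_zero hv.1 (L₄.neg_mem hn) (hvy ▸ hy) ?_
    have e : ω n v = ω n y := by rw [← hyn, map_add, ortho hL₄ hn hn, add_zero]
    simp only [map_neg, LinearMap.neg_apply]
    linarith
  · intro x hx hx0 m hm hxm
    obtain ⟨y, hy, n, hn, rfl⟩ := hL₂.exists_add_eq hω hL₄ h24 m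
    have p1 := h32.nonneg hy hn hm
    have hxn : x + n ∈ L₂ := by
      have := L₂.sub_mem hxm hy
      rwa [show x + (y + n) - y = x + n by abel] at this
    have p2 := h21 x hx hx0 n hn hxn
    have e1 := ortho hL₂ hy hxn
    have e2 : ω y n = -ω n y := by
      have := hω.2 (y + n)
      simp only [map_add, LinearMap.add_apply, hω.2] at this
      linarith
    simp only [map_add, LinearMap.add_apply] at e1 ⊢
    linarith
  · have key : ∀ x ∈ L₁, ∀ m ∈ L₄, x + m ∈ L → 0 ≤ ω m x ∧ (ω m x ≤ 0 → x + m = 0) := by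
      intro x hx m hm hp
      obtain ⟨x₂, hx₂, m₃, hm₃, hp₂⟩ := hL₂.exists_add_eq hω hL₃ h23 (x + m)
      obtain ⟨y, hy, n, hn, rfl⟩ := hL₂.exists_add_eq hω hL₄ h24 m₃
      have hz : x + (m - n) = x₂ + y := by
        rw [← add_sub_assoc, ← hp₂]; abel
      have hz₂ : x + (m - n) ∈ L₂ := hz ▸ L₂.add_mem hx₂ hy
      have hp' : x₂ + (y + n) ∈ L := hp₂ ▸ hp
      have p1 := h21.nonneg hx (L₄.sub_mem hm hn) hz₂
      have p2 := h32.nonneg hy hn hm₃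
      have p3 := hpos.nonneg hx₂ hm₃ hp'
      have e : ω m x = ω (m - n) x + ω n y + ω (y + n) x₂ := by
        have e1 := congrArg (ω n) hz
        have e2 := ortho hL₄ hn hm
        have e3 := ortho hL₂ hy hx₂
        simp only [map_add, map_sub, hω.2, LinearMap.add_apply, LinearMap.sub_apply] at e1 ⊢
        linarith
      refine ⟨by linarith, fun hle => ?_⟩
      have hx₂0 := hpos.eq_zero hx₂ hm₃ hp' (by linarith)
      have hy0 := h32.eq_zero hy hn hm₃ (by linarith)
      subst hx₂0 hy0
      rw [zero_add] at hm₃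
      rw [← hp₂, dis h34 hm₃ hn]
      simp
    refine ⟨(Submodule.eq_bot_iff _).2 fun v hv => ?_, fun x hx hx0 m hm hp => ?_⟩
    · simpa using (key 0 L₁.zero_mem v hv.2 (by simpa using hv.1)).2 (by simp)
    · by_contra h
      have h0 := (key x hx m hm hp).2 (not_lt.1 h)
      refine hx0 (dis h14 hx ?_)
      rw [eq_neg_of_add_eq_zero_left h0]
      exact L₄.neg_mem hm
end

section
/- Let (V, ω) be a symplectic vector space, L a Lagrangian subspace, and H a Lagrangian subspace transverse to L, so that (H, L) is a polarization; for each Lagrangian subspace T transverse to L write Q_T = T^{(H,L)}, a quadratic form on H. Let 𝓛 be a set of Lagrangian subspaces of V, each transverse to L, and let 𝒮(𝓛, L) be the set of Lagrangian subspaces L− transverse to L such that every T ∈ 𝓛 satisfies T ≻_{L} L− (with respect to the polarization (L−, L)). Then: (a) a Lagrangian L− transverse to L belongs to 𝒮(𝓛, L) if and only if Q_T − Q_{L−} is positive definite for every T ∈ 𝓛; in particular the set {Q_{L−} : L− ∈ 𝒮(𝓛, L)} is a convex subset of the real vector space of quadratic forms on H; (b) if {Q_T : T ∈ 𝓛} is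 a compact subset of the (finite-dimensional) space of quadratic forms on H — in particular if 𝓛 is finite — then 𝒮(𝓛, L) is nonempty. -/
open Module

variable {V : Type*} [AddCommGroup V] [Module ℝ V]

theorem IsLagrangian.apply_eq_zero {ω : V →ₗ[ℝ] V →ₗ[ℝ] ℝ} {L : Submodule ℝ V}
    (hL : IsLagrangian ω L) {v w : V} (hv : v ∈ L) (hw : w ∈ L) : ω v w = 0 :=
  hL.mem_iff.1 hv w hw

theorem IsSymplectic.apply_comm {ω : V →ₗ[ℝ] V →ₗ[ℝ] ℝ} (hω : IsSymplectic ω) (v w : V) :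
    ω v w = -ω w v :=
  ((LinearMap.IsAlt.neg (B := ω) hω.2) w v).symm

theorem IsSymplectic.finrank_lagrangian [FiniteDimensional ℝ V] {ω : V →ₗ[ℝ] V →ₗ[ℝ] ℝ}
    (hω : IsSymplectic ω) {L : Submodule ℝ V} (hL : IsLagrangian ω L) :
    finrank ℝ V = 2 * finrank ℝ L := by
  have hrefl : LinearMap.IsRefl ω := LinearMap.IsAlt.isRefl hω.2
  have hnd : LinearMap.BilinForm.Nondegenerate ω :=
    hrefl.nondegenerate_iff_separatingLeft.2 hω.1
  have horth : LinearMap.BilinForm.orthogonal ω L = L := by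
    ext v
    rw [LinearMap.BilinForm.mem_orthogonal_iff, hL.mem_iff]
    exact forall₂_congr fun x _ ↦ hrefl.eq_iff
  have h := LinearMap.BilinForm.finrank_orthogonal hnd L
  rw [horth] at h
  have := L.finrank_le
  omega

theorem IsSymplectic.isCompl_lagrangian [FiniteDimensional ℝ V] {ω : V →ₗ[ℝ] V →ₗ[ℝ] ℝ}
    (hω : IsSymplectic ω) {L T : Submodule ℝ V} (hL : IsLagrangian ω L)
    (hT : IsLagrangian ω T) (hTL : T ⊓ L = ⊥) : IsCompl T L := by
  refine ⟨disjoint_iff.2 hTL, codisjoint_iff.2 (Submodule.eq_top_of_finrank_eq ?_)⟩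
  have h := Submodule.finrank_sup_add_finrank_inf_eq T L
  rw [hTL, finrank_bot] at h
  have := hω.finrank_lagrangian hL
  have := hω.finrank_lagrangian hT
  omega

theorem eq_of_add_mem_of_inf_eq_bot {L T : Submodule ℝ V} (hTL : T ⊓ L = ⊥) {x m m' : V}
    (hm : m ∈ L) (hm' : m' ∈ L) (h : x + m ∈ T) (h' : x + m' ∈ T) : m = m' := by
  have : m - m' ∈ T ⊓ L :=
    ⟨by simpa using T.sub_mem h h', L.sub_mem hm hm'⟩
  rw [hTL, Submodule.mem_bot] at this
  exact sub_eq_zero.1 this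

/-- A Lagrangian transverse to `L` is the graph over `H` of a symmetric map `H → L`. -/
theorem IsSymplectic.exists_symmetric_of_lagrangian [FiniteDimensional ℝ V]
    {ω : V →ₗ[ℝ] V →ₗ[ℝ] ℝ} (hω : IsSymplectic ω) {L H T : Submodule ℝ V}
    (hL : IsLagrangian ω L) (hH : IsLagrangian ω H)
    (hT : IsLagrangian ω T) (hTL : T ⊓ L = ⊥) :
    ∃ A : H →ₗ[ℝ] L, (∀ x y : H, ω (A x) y = ω (A y) x) ∧ ∀ x : H, (x : V) + A x ∈ T := by
  have hc : IsCompl L T := (hω.isCompl_lagrangian hL hT hTL).symm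
  let A : H →ₗ[ℝ] L := -(Submodule.projectionOnto L T hc ∘ₗ H.subtype)
  have hA : ∀ x : H, (x : V) + A x ∈ T := by
    intro x
    have h : (L.projectionOnto T hc x : V) + T.projectionOnto L hc.symm x = x :=
      Submodule.projection_add_projection_eq_self hc (x : V)
    have : (x : V) + A x = (Submodule.projectionOnto T L hc.symm (x : V) : T) := by
      simp only [A, LinearMap.neg_apply, LinearMap.comp_apply, Submodule.subtype_apply,
        Submodule.coe_neg]
      rw [← sub_eq_add_neg, sub_eq_iff_eq_add', h]
    rw [this]
    exact Subtype.property _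
  refine ⟨A, fun x y ↦ ?_, hA⟩
  have h := hT.apply_eq_zero (hA x) (hA y)
  simp only [map_add, LinearMap.add_apply] at h
  rw [hH.apply_eq_zero x.2 y.2, hL.apply_eq_zero (A x).2 (A y).2, hω.apply_comm x (A y)] at h
  linarith

/-- The graph over `H` of a symmetric map `H → L` is a Lagrangian transverse to `L`. -/
theorem IsSymplectic.exists_lagrangian_of_symmetric [FiniteDimensional ℝ V]
    {ω : V →ₗ[ℝ] V →ₗ[ℝ] ℝ} (hω : IsSymplectic ω) {L H : Submodule ℝ V}
    (hL : IsLagrangian ω L) (hH : IsLagrangian ω H) (hHL : H ⊓ L = ⊥)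
    (A : H →ₗ[ℝ] L) (hA : ∀ x y : H, ω (A x) y = ω (A y) x) :
    ∃ T : Submodule ℝ V, IsLagrangian ω T ∧ T ⊓ L = ⊥ ∧ ∀ x : H, (x : V) + A x ∈ T := by
  have key : ∀ (x y : H) (m : V), m ∈ L → ω (x + m) (y + A y) = ω (m - A x) y := by
    intro x y m hm
    simp only [map_add, map_sub, LinearMap.add_apply, LinearMap.sub_apply]
    rw [hH.apply_eq_zero x.2 y.2, hL.apply_eq_zero hm (A y).2, hω.apply_comm x (A y), hA x y]
    ring
  have hc := hω.isCompl_lagrangian hL hH hHL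
  refine ⟨LinearMap.range (H.subtype + L.subtype ∘ₗ A), ?_, ?_, fun x ↦ ⟨x, rfl⟩⟩
  · ext v
    rw [mem_sympOrtho]
    constructor
    · intro hv
      obtain ⟨x, hx, m, hm, rfl⟩ := Submodule.mem_sup.1 (hc.sup_eq_top ▸ Submodule.mem_top : v ∈ _)
      have h0 : m - A ⟨x, hx⟩ ∈ H ⊓ L := by
        refine ⟨hH.mem_iff.2 fun y hy ↦ ?_, L.sub_mem hm (A _).2⟩
        rw [← key ⟨x, hx⟩ ⟨y, hy⟩ m hm]
        exact hv _ ⟨⟨y, hy⟩, rfl⟩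
      rw [hHL, Submodule.mem_bot, sub_eq_zero] at h0
      exact ⟨⟨x, hx⟩, by simp [h0]⟩
    · rintro ⟨x, rfl⟩ _ ⟨y, rfl⟩
      have := key x y (A x) (A x).2
      simpa using this
  · rw [eq_bot_iff]
    rintro _ ⟨⟨x, rfl⟩, hx⟩
    have hxL : (x : V) ∈ L := by
      have := L.sub_mem hx (A x).2
      simpa using this
    have : (x : V) ∈ H ⊓ L := ⟨x.2, hxL⟩
    rw [hHL, Submodule.mem_bot, Submodule.coe_eq_zero] at this
    simp [this]

theorem IsSymplectic.posRel_iff [FiniteDimensional ℝ V]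
    {ω : V →ₗ[ℝ] V →ₗ[ℝ] ℝ} (hω : IsSymplectic ω) {L H T Lm : Submodule ℝ V}
    (hL : IsLagrangian ω L) (hH : IsLagrangian ω H) (hHL : H ⊓ L = ⊥) (hLm : Lm ⊓ L = ⊥) :
    PosRel ω T Lm L ↔ ∀ x ∈ H, x ≠ 0 → ∀ m ∈ L, ∀ m' ∈ L,
      x + m ∈ T → x + m' ∈ Lm → 0 < ω m x - ω m' x := by
  have hc := hω.isCompl_lagrangian hL hH hHL
  constructor
  · intro h x hx hx0 m hm m' hm' hT hm'L
    have hne : x + m' ≠ 0 := by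
      intro h0
      have : x ∈ H ⊓ L := ⟨hx, eq_neg_of_add_eq_zero_left h0 ▸ L.neg_mem hm'⟩
      rw [hHL] at this
      exact hx0 (by simpa using this)
    have := h (x + m') hm'L hne (m - m') (L.sub_mem hm hm') (by convert hT using 1; abel)
    rw [map_add, hL.apply_eq_zero (L.sub_mem hm hm') hm'] at this
    simpa using this
  · intro h y hy hy0 k hk hT
    obtain ⟨x, hx, m', hm', rfl⟩ := Submodule.mem_sup.1 (hc.sup_eq_top ▸ Submodule.mem_top : y ∈ _)
    have hx0 : x ≠ 0 := by
      rintro rfl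
      have : 0 + m' ∈ Lm ⊓ L := ⟨hy, by simpa using hm'⟩
      rw [hLm] at this
      exact hy0 (by simpa using this)
    have := h x hx hx0 (m' + k) (L.add_mem hm' hk) m' hm' (by rwa [← add_assoc]) hy
    rw [map_add, hL.apply_eq_zero hk hm']
    simpa using this

/-- The positivity criterion in terms of symmetric maps. -/
theorem IsSymplectic.posRel_of_symmetric [FiniteDimensional ℝ V]
    {ω : V →ₗ[ℝ] V →ₗ[ℝ] ℝ} (hω : IsSymplectic ω) {L H T Lm : Submodule ℝ V}
    (hL : IsLagrangian ω L) (hH : IsLagrangian ω H) (hHL : H ⊓ L = ⊥)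
    (hT : T ⊓ L = ⊥) (hLm : Lm ⊓ L = ⊥) {A B : H →ₗ[ℝ] L}
    (hA : ∀ x : H, (x : V) + A x ∈ T) (hB : ∀ x : H, (x : V) + B x ∈ Lm) :
    PosRel ω T Lm L ↔ ∀ x : H, x ≠ 0 → ω (B x) x < ω (A x) x := by
  rw [hω.posRel_iff hL hH hHL hLm]
  constructor
  · intro h x hx
    have := h x x.2 (by simpa using hx) _ (A x).2 _ (B x).2 (hA x) (hB x)
    linarith
  · intro h x hx hx0 m hm m' hm' hmT hmL
    rw [eq_of_add_mem_of_inf_eq_bot hT hm (A _).2 hmT (hA ⟨x, hx⟩),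
      eq_of_add_mem_of_inf_eq_bot hLm hm' (B _).2 hmL (hB ⟨x, hx⟩)]
    have := h ⟨x, hx⟩ (by simpa using hx0)
    simp only at this
    linarith

/-- Transverse Lagrangians are in duality through `ω`. -/
theorem IsSymplectic.exists_linearMap_eq [FiniteDimensional ℝ V]
    {ω : V →ₗ[ℝ] V →ₗ[ℝ] ℝ} (hω : IsSymplectic ω) {L H : Submodule ℝ V}
    (hL : IsLagrangian ω L) (hH : IsLagrangian ω H) (hHL : H ⊓ L = ⊥)
    (β : H →ₗ[ℝ] H →ₗ[ℝ] ℝ) :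
    ∃ B : H →ₗ[ℝ] L, ∀ x y : H, ω (B x) y = β x y := by
  let Φ : L →ₗ[ℝ] Dual ℝ H := ω.domRestrict₁₂ L H
  have hinj : Function.Injective Φ := by
    rw [injective_iff_map_eq_zero]
    intro l hl
    have : (l : V) ∈ H ⊓ L := by
      refine ⟨hH.mem_iff.2 fun y hy ↦ ?_, l.2⟩
      exact LinearMap.congr_fun hl ⟨y, hy⟩
    rw [hHL] at this
    simpa using this
  have hdim : finrank ℝ L = finrank ℝ (Dual ℝ H) := by
    rw [Subspace.dual_finrank_eq]
    have := hω.finrank_lagrangian hL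
    have := hω.finrank_lagrangian hH
    omega
  let e := LinearEquiv.ofInjectiveOfFinrankEq Φ hinj hdim
  refine ⟨e.symm.toLinearMap ∘ₗ β, fun x y ↦ ?_⟩
  have h : Φ (e.symm (β x)) = β x := e.apply_symm_apply (β x)
  exact LinearMap.congr_fun h y

/-- A symmetric form whose coefficients in a basis are bounded by `C` is bounded by
`∑ i, ∑ j, C i j` times the sum of the squares of the coordinates. -/
theorem abs_apply_self_le_sum_mul {ι E : Type*} [Fintype ι] [AddCommGroup E] [Module ℝ E]
    (b : Basis ι ℝ E) (q : E →ₗ[ℝ] E →ₗ[ℝ] ℝ) (C : ι → ι → ℝ)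
    (hC : ∀ i j, |q (b i) (b j)| ≤ C i j) (x : E) :
    |q x x| ≤ (∑ i, ∑ j, C i j) * ∑ k, b.repr x k ^ 2 := by
  have hq : q x x = ∑ i, ∑ j, b.repr x i * (b.repr x j * q (b i) (b j)) := by
    rw [← LinearMap.sum_repr_mul_repr_mul b b (B := q) x x, Finsupp.sum_fintype _ _ (by simp)]
    exact Finset.sum_congr rfl fun i _ ↦ by rw [Finsupp.sum_fintype _ _ (by simp)]; rfl
  have hle : ∀ i, b.repr x i ^ 2 ≤ ∑ k, b.repr x k ^ 2 := fun i ↦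
    Finset.single_le_sum (f := fun k ↦ b.repr x k ^ 2) (fun _ _ ↦ sq_nonneg _)
      (Finset.mem_univ i)
  rw [hq, Finset.sum_mul]
  refine (Finset.abs_sum_le_sum_abs _ _).trans (Finset.sum_le_sum fun i _ ↦ ?_)
  rw [Finset.sum_mul]
  refine (Finset.abs_sum_le_sum_abs _ _).trans (Finset.sum_le_sum fun j _ ↦ ?_)
  have h1 : |b.repr x i| * |b.repr x j| ≤ ∑ k, b.repr x k ^ 2 := by
    have := hle i
    have := hle j
    have := two_mul_le_add_sq |b.repr x i| |b.repr x j|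
    simp only [sq_abs] at this
    linarith
  rw [← mul_assoc, abs_mul, abs_mul, mul_comm]
  exact mul_le_mul (hC i j) h1 (by positivity) ((abs_nonneg _).trans (hC i j))

/-- Let (V, ω) be a symplectic vector space, L a Lagrangian subspace and H a
Lagrangian subspace transverse to L, so that (H, L) is a polarization; for a
Lagrangian T transverse to L, its quadratic form Q_T = T^{(H,L)} on H is the function
sending x ∈ H to ω(m, x) for the (unique) m ∈ L with x + m ∈ T. Let 𝓛 be a set of
Lagrangian subspaces each transverse to L, and let 𝒮(𝓛, L) consist of the Lagrangians
L− transverse to L with T ≻_L L− (w.r.t. the polarization (L−, L)) for all T ∈ 𝓛.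
Then: (a) L− ∈ 𝒮(𝓛, L) iff Q_T − Q_{L−} is positive definite for every T ∈ 𝓛; in
particular the corresponding set of quadratic forms is convex: for L₁, L₂ ∈ 𝒮(𝓛, L)
and t ∈ [0,1] there is a Lagrangian L₃ ∈ 𝒮(𝓛, L) transverse to L whose quadratic form
is t·Q_{L₁} + (1−t)·Q_{L₂}; (b) if the set of quadratic forms {Q_T : T ∈ 𝓛} is
compact (as a set of functions H → ℝ; in particular if 𝓛 is finite), then 𝒮(𝓛, L) is
nonempty. -/
theorem lagrangian_lower_bound_set_convex_nonempty [FiniteDimensional ℝ V]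
    (ω : V →ₗ[ℝ] V →ₗ[ℝ] ℝ) (hω : IsSymplectic ω)
    (L H : Submodule ℝ V) (hL : IsLagrangian ω L) (hH : IsLagrangian ω H)
    (hHL : H ⊓ L = ⊥)
    (𝓛 : Set (Submodule ℝ V))
    (h𝓛 : ∀ T ∈ 𝓛, IsLagrangian ω T ∧ T ⊓ L = ⊥) :
    ((∀ Lm : Submodule ℝ V, IsLagrangian ω Lm → Lm ⊓ L = ⊥ →
        ((∀ T ∈ 𝓛, PosRel ω T Lm L) ↔
          (∀ T ∈ 𝓛, ∀ x ∈ H, x ≠ 0 → ∀ m ∈ L, ∀ m' ∈ L,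
            x + m ∈ T → x + m' ∈ Lm → 0 < ω m x - ω m' x))) ∧
      (∀ L₁ L₂ : Submodule ℝ V, ∀ t : ℝ, 0 ≤ t → t ≤ 1 →
        IsLagrangian ω L₁ → L₁ ⊓ L = ⊥ → (∀ T ∈ 𝓛, PosRel ω T L₁ L) →
        IsLagrangian ω L₂ → L₂ ⊓ L = ⊥ → (∀ T ∈ 𝓛, PosRel ω T L₂ L) →
        ∃ L₃ : Submodule ℝ V, IsLagrangian ω L₃ ∧ L₃ ⊓ L = ⊥ ∧
          (∀ x ∈ H, ∀ m₁ ∈ L, ∀ m₂ ∈ L, ∀ m₃ ∈ L,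
            x + m₁ ∈ L₁ → x + m₂ ∈ L₂ → x + m₃ ∈ L₃ →
            ω m₃ x = t * ω m₁ x + (1 - t) * ω m₂ x) ∧
          (∀ T ∈ 𝓛, PosRel ω T L₃ L))) ∧
    (IsCompact {f : H → ℝ |
        ∃ T ∈ 𝓛, ∀ (x : H), ∀ m ∈ L, (x : V) + m ∈ T → f x = ω m (x : V)} →
      ∃ Lm : Submodule ℝ V, IsLagrangian ω Lm ∧ Lm ⊓ L = ⊥ ∧
        ∀ T ∈ 𝓛, PosRel ω T Lm L) := by
  refine ⟨⟨fun Lm _ hLm ↦ forall₂_congr fun T _ ↦ hω.posRel_iff hL hH hHL hLm, ?_⟩, ?_⟩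
  · intro L₁ L₂ t ht0 ht1 h₁ h₁L hp₁ h₂ h₂L hp₂
    obtain ⟨A₁, hs₁, hA₁⟩ := hω.exists_symmetric_of_lagrangian hL hH h₁ h₁L
    obtain ⟨A₂, hs₂, hA₂⟩ := hω.exists_symmetric_of_lagrangian hL hH h₂ h₂L
    have hform : ∀ x y : H, ω ((t • A₁ + (1 - t) • A₂) x : L) y
        = t * ω (A₁ x) y + (1 - t) * ω (A₂ x) y := by
      intro x y
      simp
    obtain ⟨L₃, h₃, h₃L, hA₃⟩ := hω.exists_lagrangian_of_symmetric hL hH hHL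
      (t • A₁ + (1 - t) • A₂) (fun x y ↦ by rw [hform, hform, hs₁ x y, hs₂ x y])
    refine ⟨L₃, h₃, h₃L, ?_, fun T hT ↦ ?_⟩
    · intro x hx m₁ hm₁ m₂ hm₂ m₃ hm₃ hx₁ hx₂ hx₃
      rw [eq_of_add_mem_of_inf_eq_bot h₁L hm₁ (A₁ _).2 hx₁ (hA₁ ⟨x, hx⟩),
        eq_of_add_mem_of_inf_eq_bot h₂L hm₂ (A₂ _).2 hx₂ (hA₂ ⟨x, hx⟩),
        eq_of_add_mem_of_inf_eq_bot h₃L hm₃ (Subtype.property _) hx₃ (hA₃ ⟨x, hx⟩)]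
      exact hform ⟨x, hx⟩ ⟨x, hx⟩
    · obtain ⟨hTl, hTL⟩ := h𝓛 T hT
      obtain ⟨A, -, hA⟩ := hω.exists_symmetric_of_lagrangian hL hH hTl hTL
      rw [hω.posRel_of_symmetric hL hH hHL hTL h₃L hA hA₃]
      intro x hx
      have hlt₁ := (hω.posRel_of_symmetric hL hH hHL hTL h₁L hA hA₁).1 (hp₁ T hT) x hx
      have hlt₂ := (hω.posRel_of_symmetric hL hH hHL hTL h₂L hA hA₂).1 (hp₂ T hT) x hx
      rw [hform]
      have := convex_Iio (𝕜 := ℝ) (ω (A x) x) hlt₁ hlt₂ ht0 (sub_nonneg.2 ht1) (by ring)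
      simpa using this
  · intro hK
    have hbound : ∀ x : H, ∃ M : ℝ, ∀ f ∈ {f : H → ℝ |
        ∃ T ∈ 𝓛, ∀ (x : H), ∀ m ∈ L, (x : V) + m ∈ T → f x = ω m (x : V)}, ‖f x‖ ≤ M :=
      fun x ↦ hK.exists_bound_of_continuousOn (continuous_apply x).continuousOn
    choose M hM using hbound
    let b := finBasis ℝ H
    let C := fun i j ↦ (M (b i + b j) + M (b i) + M (b j)) / 2
    let c := (∑ i, ∑ j, C i j) + 1
    let β : H →ₗ[ℝ] H →ₗ[ℝ] ℝ :=
      ∑ k, (-c) • (LinearMap.mul ℝ ℝ).compl₁₂ (b.coord k) (b.coord k)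
    have hβ : ∀ x y, β x y = -c * ∑ k, b.repr x k * b.repr y k := by
      intro x y
      simp [β, Finset.mul_sum, LinearMap.sum_apply]
    obtain ⟨B, hB⟩ := hω.exists_linearMap_eq hL hH hHL β
    obtain ⟨Lm, hLm, hLmL, hBm⟩ := hω.exists_lagrangian_of_symmetric hL hH hHL B
      (fun x y ↦ by simp only [hB, hβ, mul_comm])
    refine ⟨Lm, hLm, hLmL, fun T hT ↦ ?_⟩
    obtain ⟨hTl, hTL⟩ := h𝓛 T hT
    obtain ⟨A, hs, hA⟩ := hω.exists_symmetric_of_lagrangian hL hH hTl hTL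
    rw [hω.posRel_of_symmetric hL hH hHL hTL hLmL hA hBm]
    intro x hx
    have hQ : ∀ y : H, |ω (A y) y| ≤ M y := fun y ↦
      hM y (fun z ↦ ω (A z) z) ⟨T, hT, fun z m hm hz ↦ by
        rw [eq_of_add_mem_of_inf_eq_bot hTL hm (A _).2 hz (hA z)]⟩
    have hcoeff : ∀ i j, |(ω.domRestrict₁₂ L H ∘ₗ A) (b i) (b j)| ≤ C i j := by
      intro i j
      have h₁ := abs_le.1 (hQ (b i + b j))
      have h₂ := abs_le.1 (hQ (b i))
      have h₃ := abs_le.1 (hQ (b j))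
      simp only [map_add, Submodule.coe_add, LinearMap.add_apply] at h₁
      rw [hs (b j) (b i)] at h₁
      simp only [LinearMap.comp_apply, LinearMap.domRestrict₁₂_apply, C]
      rw [abs_le]
      constructor <;> linarith
    have hle := (abs_le.1 (abs_apply_self_le_sum_mul b _ C hcoeff x)).1
    simp only [LinearMap.comp_apply, LinearMap.domRestrict₁₂_apply] at hle
    have hpos : 0 < ∑ k, b.repr x k ^ 2 := by
      obtain ⟨k, hk⟩ : ∃ k, b.repr x k ≠ 0 := by
        by_contra! h
        exact hx (b.ext_elem fun k ↦ by simpa using h k)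
      exact Finset.sum_pos' (fun _ _ ↦ sq_nonneg _) ⟨k, Finset.mem_univ k, by positivity⟩
    rw [hB, hβ]
    simp only [← sq, c]
    linarith
end

section
/- Let V be a real vector space of dimension 2n (n ≥ 1) with a basis u_1, …, u_{2n}, let V_j = span(u_1, …, u_j) for 0 ≤ j ≤ 2n, and let Ω(F) be the set of nondegenerate alternating bilinear forms ω on V with V_j^{⊥ω} = V_{2n−j} for all 0 ≤ j ≤ 2n. Then: (1) every ω ∈ Ω(F) satisfies ω(u_j, u_{2n+1−j}) ≠ 0 for each j = 1, …, n; (2) for every sign vector ε ∈ {−1, +1}ⁿ, the set Ω_ε(F) = {ω ∈ Ω(F) : ε_j · ω(u_j, u_{2n+1−j}) > 0 for all j = 1, …, n} is nonempty and convex; (3) consequently, two forms ω, ω' ∈ Ω(F) lie in the same path component of Ω(F) if and only if ω(u_j, u_{2n+1−j}) and ω'(u_j, u_{2n+1−j}) have the same sign for every j = 1, …, n. -/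
open Module

variable {V : Type*} [AddCommGroup V] [Module ℝ V]

/-- The `j`-th member `V_j = span(u_1, …, u_j)` of the full flag determined by the
basis `u` of a `2n`-dimensional space. -/
def flagSub (n : ℕ) (u : Basis (Fin (2 * n)) ℝ V) (j : ℕ) : Submodule ℝ V :=
  Submodule.span ℝ (u '' {i : Fin (2 * n) | (i : ℕ) < j})

/-- The index of `u_j` (`1 ≤ j ≤ n`, zero-indexed) inside `Fin (2n)`. -/
def idxLow (n : ℕ) (j : Fin n) : Fin (2 * n) :=
  ⟨j.val, by have := j.isLt; omega⟩

/-- The index of `u_{2n+1-j}` (`1 ≤ j ≤ n`, zero-indexed) inside `Fin (2n)`. -/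
def idxHigh (n : ℕ) (j : Fin n) : Fin (2 * n) :=
  ⟨2 * n - 1 - j.val, by have := j.isLt; omega⟩

/-- `Ω(F)`: the set of nondegenerate alternating bilinear forms `ω` on `V` such that
`V_j^{⊥ω} = V_{2n−j}` for all `0 ≤ j ≤ 2n`, where `V_j = span(u_1, …, u_j)`. -/
def FlagForms (n : ℕ) (u : Basis (Fin (2 * n)) ℝ V) : Set (V →ₗ[ℝ] V →ₗ[ℝ] ℝ) :=
  {ω | (∀ v : V, (∀ w : V, ω v w = 0) → v = 0) ∧ (∀ v : V, ω v v = 0) ∧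
    ∀ j : ℕ, j ≤ 2 * n → SympOrtho ω (flagSub n u j) = flagSub n u (2 * n - j)}

theorem mem_flagSub_iff (n : ℕ) (u : Basis (Fin (2 * n)) ℝ V) (j : ℕ) (v : V) :
    v ∈ flagSub n u j ↔ ∀ i : Fin (2 * n), j ≤ (i : ℕ) → u.repr v i = 0 := by
  rw [flagSub, Basis.mem_span_image]
  constructor
  · intro h i hi
    by_contra hne
    have := h (Finsupp.mem_support_iff.2 hne)
    simp only [Set.mem_ofPred_eq] at this
    omega
  · intro h i hi
    by_contra hlt
    simp only [Set.mem_ofPred_eq, not_lt] at hlt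
    exact Finsupp.mem_support_iff.1 hi (h i hlt)

theorem basis_mem_flagSub (n : ℕ) (u : Basis (Fin (2 * n)) ℝ V) {j : ℕ} {i : Fin (2 * n)}
    (h : (i : ℕ) < j) : u i ∈ flagSub n u j :=
  Submodule.subset_span ⟨i, h, rfl⟩

theorem mem_sympOrtho_flagSub_iff (ω : V →ₗ[ℝ] V →ₗ[ℝ] ℝ) (n : ℕ)
    (u : Basis (Fin (2 * n)) ℝ V) (j : ℕ) (v : V) :
    v ∈ SympOrtho ω (flagSub n u j) ↔ ∀ i : Fin (2 * n), (i : ℕ) < j → ω v (u i) = 0 := by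
  simp only [SympOrtho, Submodule.mem_iInf, LinearMap.mem_ker, LinearMap.flip_apply]
  refine ⟨fun h i hi => h _ (basis_mem_flagSub n u hi), fun h x hx => ?_⟩
  have hle : flagSub n u j ≤ LinearMap.ker (ω v) := by
    refine Submodule.span_le.2 ?_
    rintro _ ⟨i, hi, rfl⟩
    exact h i hi
  exact hle hx

/-- Forms compatible with the flag have an anti-triangular Gram matrix with nonzero
antidiagonal. -/
theorem gram_of_mem_flagForms {n : ℕ} {u : Basis (Fin (2 * n)) ℝ V} {ω : V →ₗ[ℝ] V →ₗ[ℝ] ℝ}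
    (hω : ω ∈ FlagForms n u) :
    (∀ i k : Fin (2 * n), (i : ℕ) + k + 1 < 2 * n → ω (u i) (u k) = 0) ∧
      ∀ j : Fin n, ω (u (idxLow n j)) (u (idxHigh n j)) ≠ 0 := by
  obtain ⟨-, -, hflag⟩ := hω
  have hzero : ∀ i k : Fin (2 * n), (i : ℕ) + k + 1 < 2 * n → ω (u i) (u k) = 0 := by
    intro i k hik
    have hmem : u i ∈ SympOrtho ω (flagSub n u (k + 1)) := by
      rw [hflag _ (by omega)]
      exact basis_mem_flagSub n u (by omega)
    exact (mem_sympOrtho_flagSub_iff ω n u _ _).1 hmem k (by omega)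
  refine ⟨hzero, fun j hj => ?_⟩
  have hjn := j.isLt
  have hmem : u (idxLow n j) ∈ SympOrtho ω (flagSub n u (2 * n - j)) := by
    rw [mem_sympOrtho_flagSub_iff]
    intro i hi
    rcases Nat.lt_or_ge (i : ℕ) (2 * n - 1 - j) with h | h
    · exact hzero _ _ (by simp only [idxLow]; omega)
    · have : i = idxHigh n j := Fin.ext (by simp only [idxHigh]; omega)
      rw [this, hj]
  rw [hflag _ (by omega), mem_flagSub_iff] at hmem
  have := hmem (idxLow n j) (by simp only [idxLow]; omega)
  simp at this

theorem mem_flagForms_of_gram {n : ℕ} {u : Basis (Fin (2 * n)) ℝ V} {ω : V →ₗ[ℝ] V →ₗ[ℝ] ℝ}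
    (halt : ∀ v, ω v v = 0)
    (hzero : ∀ i k : Fin (2 * n), (i : ℕ) + k + 1 < 2 * n → ω (u i) (u k) = 0)
    (hne : ∀ j : Fin n, ω (u (idxLow n j)) (u (idxHigh n j)) ≠ 0) :
    ω ∈ FlagForms n u := by
  have hanti : ∀ i k : Fin (2 * n), (i : ℕ) + k + 1 = 2 * n → ω (u i) (u k) ≠ 0 := by
    intro i k hik
    rcases Nat.lt_or_ge (i : ℕ) n with h | h
    · have hi : i = idxLow n ⟨i, h⟩ := rfl
      have hk : k = idxHigh n ⟨i, h⟩ := Fin.ext (by simp only [idxHigh]; omega)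
      rw [hk]
      exact hne ⟨i, h⟩
    · have hkn : (k : ℕ) < n := by omega
      have hi : i = idxHigh n ⟨k, hkn⟩ := Fin.ext (by simp only [idxHigh]; omega)
      rw [← LinearMap.IsAlt.neg halt, neg_ne_zero, hi]
      exact hne ⟨k, hkn⟩
  have hexpand : ∀ v w, ω v w = ∑ i, u.repr v i * ω (u i) w := by
    intro v w
    conv_lhs => rw [← u.sum_repr v]
    simp only [map_sum, map_smul, LinearMap.sum_apply, LinearMap.smul_apply, smul_eq_mul]
  have hflag : ∀ j : ℕ, j ≤ 2 * n →
      SympOrtho ω (flagSub n u j) = flagSub n u (2 * n - j) := by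
    intro j hj
    ext v
    rw [mem_sympOrtho_flagSub_iff, mem_flagSub_iff]
    constructor
    · intro h
      by_contra! hcon
      obtain ⟨i₀, hi₀, hv₀⟩ := hcon
      obtain ⟨i, hi, hmax⟩ := Finset.exists_max_image (u.repr v).support (fun i => i)
        ⟨i₀, Finsupp.mem_support_iff.2 hv₀⟩
      have hle : (i₀ : ℕ) ≤ i := hmax i₀ (Finsupp.mem_support_iff.2 hv₀)
      have hrev : (i : ℕ) + i.rev + 1 = 2 * n := by rw [Fin.val_rev]; omega
      have hval := h i.rev (by omega)
      rw [hexpand, Finset.sum_eq_single i] at hval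
      · exact (mul_ne_zero (Finsupp.mem_support_iff.1 hi) (hanti _ _ hrev)) hval
      · intro k _ hki
        rcases lt_or_gt_of_ne hki with hlt | hgt
        · rw [hzero k i.rev (by have : (k : ℕ) < i := hlt; omega), mul_zero]
        · have : u.repr v k = 0 := by
            by_contra hk
            exact absurd (hmax k (Finsupp.mem_support_iff.2 hk)) (not_le.2 hgt)
          rw [this, zero_mul]
      · simp
    · intro h i hi
      rw [hexpand]
      refine Finset.sum_eq_zero fun k _ => ?_
      rcases Nat.lt_or_ge (k : ℕ) (2 * n - j) with hk | hk
      · rw [hzero k i (by omega), mul_zero]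
      · rw [h k hk, zero_mul]
  refine ⟨fun v hv => ?_, halt, hflag⟩
  have hmem : v ∈ SympOrtho ω (flagSub n u (2 * n)) := by
    rw [mem_sympOrtho_flagSub_iff]
    exact fun i _ => hv _
  rw [hflag _ le_rfl, mem_flagSub_iff] at hmem
  exact u.ext_elem fun i => by simpa using hmem i (by omega)

theorem convex_flagForms_sign (n : ℕ) (u : Basis (Fin (2 * n)) ℝ V) (ε : Fin n → ℝ) :
    Convex ℝ {ω ∈ FlagForms n u |
      ∀ j : Fin n, 0 < ε j * ω (u (idxLow n j)) (u (idxHigh n j))} := by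
  rintro ω ⟨hω, hpos⟩ ω' ⟨hω', hpos'⟩ a b ha hb hab
  have hsign : ∀ j : Fin n,
      0 < ε j * (a • ω + b • ω') (u (idxLow n j)) (u (idxHigh n j)) := by
    intro j
    have := convex_Ioi (0 : ℝ) (hpos j) (hpos' j) ha hb hab
    simp only [Set.mem_Ioi, smul_eq_mul] at this
    simp only [LinearMap.add_apply, LinearMap.smul_apply, smul_eq_mul]
    linarith
  refine ⟨mem_flagForms_of_gram (fun v => ?_) (fun i k hik => ?_) fun j => ?_, hsign⟩
  · simp [hω.2.1 v, hω'.2.1 v]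
  · simp [(gram_of_mem_flagForms hω).1 i k hik, (gram_of_mem_flagForms hω').1 i k hik]
  · exact right_ne_zero_of_mul (hsign j).ne'

/-- The form `∑ j, ε j • (u_j^* ∧ u_{2n+1-j}^*)`. -/
noncomputable def antidiagonalForm (n : ℕ) (u : Basis (Fin (2 * n)) ℝ V) (ε : Fin n → ℝ) :
    V →ₗ[ℝ] V →ₗ[ℝ] ℝ :=
  ∑ j, ε j • ((u.coord (idxLow n j)).smulRight (u.coord (idxHigh n j)) -
    (u.coord (idxHigh n j)).smulRight (u.coord (idxLow n j)))

theorem antidiagonalForm_apply (n : ℕ) (u : Basis (Fin (2 * n)) ℝ V) (ε : Fin n → ℝ) (v w : V) :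
    antidiagonalForm n u ε v w =
      ∑ j, ε j * (u.repr v (idxLow n j) * u.repr w (idxHigh n j) -
        u.repr v (idxHigh n j) * u.repr w (idxLow n j)) := by
  simp [antidiagonalForm]

theorem antidiagonalForm_low_high (n : ℕ) (u : Basis (Fin (2 * n)) ℝ V) (ε : Fin n → ℝ)
    (j : Fin n) : antidiagonalForm n u ε (u (idxLow n j)) (u (idxHigh n j)) = ε j := by
  rw [antidiagonalForm_apply, Finset.sum_eq_single j]
  · have : idxLow n j ≠ idxHigh n j := by
      simp only [idxLow, idxHigh, ne_eq, Fin.mk.injEq]; omega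
    simp [this]
  · intro k _ hk
    have h₁ : idxLow n j ≠ idxLow n k := by
      simp only [idxLow, ne_eq, Fin.mk.injEq]; omega
    have h₂ : idxLow n j ≠ idxHigh n k := by
      simp only [idxLow, idxHigh, ne_eq, Fin.mk.injEq]; omega
    simp [Finsupp.single_apply, h₁, h₂]
  · simp

theorem antidiagonalForm_mem (n : ℕ) (u : Basis (Fin (2 * n)) ℝ V) {ε : Fin n → ℝ}
    (hε : ∀ j, ε j ≠ 0) : antidiagonalForm n u ε ∈ FlagForms n u := by
  refine mem_flagForms_of_gram (fun v => ?_) (fun i k hik => ?_) fun j => ?_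
  · rw [antidiagonalForm_apply]
    exact Finset.sum_eq_zero fun j _ => by ring
  · rw [antidiagonalForm_apply]
    refine Finset.sum_eq_zero fun j _ => ?_
    have h₁ : ¬(i = idxLow n j ∧ k = idxHigh n j) := by
      simp only [idxLow, idxHigh, Fin.ext_iff]; omega
    have h₂ : ¬(i = idxHigh n j ∧ k = idxLow n j) := by
      simp only [idxLow, idxHigh, Fin.ext_iff]; omega
    simp only [Basis.repr_self, Finsupp.single_apply, ← ite_and, mul_ite, mul_one, mul_zero]
    grind
  · rw [antidiagonalForm_low_high]
    exact hε j

theorem joinedIn_flagForms_of_sign {n : ℕ} {u : Basis (Fin (2 * n)) ℝ V}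
    {ω ω' : V →ₗ[ℝ] V →ₗ[ℝ] ℝ} (hω : ω ∈ FlagForms n u) (hω' : ω' ∈ FlagForms n u)
    (h : ∀ j : Fin n, 0 < ω (u (idxLow n j)) (u (idxHigh n j)) *
      ω' (u (idxLow n j)) (u (idxHigh n j))) :
    JoinedIn {f : V → V → ℝ | ∃ ω₀ ∈ FlagForms n u, f = fun x y => ω₀ x y}
      (fun x y => ω x y) (fun x y => ω' x y) := by
  let eval : (V →ₗ[ℝ] V →ₗ[ℝ] ℝ) →ₗ[ℝ] (V → V → ℝ) :=
    { toFun := fun ω x y => ω x y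
      map_add' := fun _ _ => rfl
      map_smul' := fun _ _ => rfl }
  let S := {ω₀ ∈ FlagForms n u | ∀ j : Fin n,
    0 < ω (u (idxLow n j)) (u (idxHigh n j)) * ω₀ (u (idxLow n j)) (u (idxHigh n j))}
  have hconv : Convex ℝ (eval '' S) := (convex_flagForms_sign n u _).linear_image eval
  have hmem : eval ω ∈ eval '' S :=
    ⟨ω, ⟨hω, fun j => mul_self_pos.2 ((gram_of_mem_flagForms hω).2 j)⟩, rfl⟩
  have hmem' : eval ω' ∈ eval '' S := ⟨ω', ⟨hω', h⟩, rfl⟩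
  refine ((hconv.isPathConnected ⟨_, hmem⟩).joinedIn _ hmem _ hmem').mono ?_
  rintro _ ⟨ω₀, hω₀, rfl⟩
  exact ⟨ω₀, hω₀.1, rfl⟩

theorem sign_of_joinedIn_flagForms {n : ℕ} {u : Basis (Fin (2 * n)) ℝ V}
    {ω ω' : V →ₗ[ℝ] V →ₗ[ℝ] ℝ}
    (h : JoinedIn {f : V → V → ℝ | ∃ ω₀ ∈ FlagForms n u, f = fun x y => ω₀ x y}
      (fun x y => ω x y) (fun x y => ω' x y)) (j : Fin n) :
    0 < ω (u (idxLow n j)) (u (idxHigh n j)) * ω' (u (idxLow n j)) (u (idxHigh n j)) := by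
  obtain ⟨γ, hγ⟩ := h
  let g : unitInterval → ℝ := fun t => γ t (u (idxLow n j)) (u (idxHigh n j))
  have hg : Continuous g :=
    (continuous_apply_apply (u (idxLow n j)) (u (idxHigh n j))).comp γ.continuous
  have hg0 : g 0 = ω (u (idxLow n j)) (u (idxHigh n j)) := by simp [g]
  have hg1 : g 1 = ω' (u (idxLow n j)) (u (idxHigh n j)) := by simp [g]
  have hne : ∀ t, g t ≠ 0 := by
    intro t
    obtain ⟨ω₀, hω₀, heq⟩ := hγ t
    simp only [g, heq]
    exact (gram_of_mem_flagForms hω₀).2 j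
  rw [← hg0, ← hg1]
  by_contra! hle
  obtain ⟨t, ht⟩ : (0 : ℝ) ∈ Set.range g := by
    rcases mul_nonpos_iff.1 hle with ⟨h0, h1⟩ | ⟨h0, h1⟩
    · exact mem_range_of_exists_le_of_exists_ge hg ⟨1, h1⟩ ⟨0, h0⟩
    · exact mem_range_of_exists_le_of_exists_ge hg ⟨0, h0⟩ ⟨1, h1⟩
  exact hne t ht

/-- Let V be a real vector space of dimension 2n (n ≥ 1) with basis u_1, …, u_{2n},
V_j = span(u_1, …, u_j) and Ω(F) the set of nondegenerate alternating bilinear forms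
ω with V_j^{⊥ω} = V_{2n−j} for all j. Then: (1) every ω ∈ Ω(F) satisfies
ω(u_j, u_{2n+1−j}) ≠ 0 for j = 1, …, n; (2) for every sign vector ε ∈ {−1,+1}ⁿ the
set Ω_ε(F) = {ω ∈ Ω(F) : ε_j·ω(u_j, u_{2n+1−j}) > 0 for all j} is nonempty and
convex; (3) two forms ω, ω' ∈ Ω(F) lie in the same path component of Ω(F) (as a set
of bilinear maps, via the evaluation embedding into the function space V → V → ℝ with
its topology of pointwise convergence) iff ω(u_j, u_{2n+1−j}) and ω'(u_j, u_{2n+1−j})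
have the same sign for every j, i.e. iff their product is positive. -/
theorem flag_forms_components (n : ℕ) (hn : 1 ≤ n) (u : Basis (Fin (2 * n)) ℝ V) :
    (∀ ω ∈ FlagForms n u, ∀ j : Fin n,
      ω (u (idxLow n j)) (u (idxHigh n j)) ≠ 0) ∧
    (∀ ε : Fin n → ℝ, (∀ j, ε j = 1 ∨ ε j = -1) →
      Set.Nonempty {ω ∈ FlagForms n u |
        ∀ j : Fin n, 0 < ε j * ω (u (idxLow n j)) (u (idxHigh n j))} ∧
      Convex ℝ {ω ∈ FlagForms n u |
        ∀ j : Fin n, 0 < ε j * ω (u (idxLow n j)) (u (idxHigh n j))}) ∧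
    (∀ ω ∈ FlagForms n u, ∀ ω' ∈ FlagForms n u,
      (JoinedIn {f : V → V → ℝ | ∃ ω₀ ∈ FlagForms n u, f = fun x y => ω₀ x y}
          (fun x y => ω x y) (fun x y => ω' x y) ↔
        ∀ j : Fin n,
          0 < ω (u (idxLow n j)) (u (idxHigh n j)) *
              ω' (u (idxLow n j)) (u (idxHigh n j)))) := by
  refine ⟨fun ω hω => (gram_of_mem_flagForms hω).2, fun ε hε => ⟨?_, convex_flagForms_sign n u ε⟩,
    fun ω hω ω' hω' => ⟨sign_of_joinedIn_flagForms, joinedIn_flagForms_of_sign hω hω'⟩⟩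
  have hne : ∀ j, ε j ≠ 0 := fun j => by rcases hε j with h | h <;> simp [h]
  refine ⟨antidiagonalForm n u ε, antidiagonalForm_mem n u hne, fun j => ?_⟩
  rw [antidiagonalForm_low_high]
  exact mul_self_pos.2 (hne j)
end

section
/- Let ε > 0 and let ψ : ℝ → ℝ be a smooth function such that ψ = 0 on [0, ∞), ψ = 1 on (−∞, −ε], and ψ < 1 and ψ' < 0 on (−ε, 0). Define h(q) = ∫₀^q ψ(t)·t dt, φ(q, p) = p² − h(q), and the vector field Z(q, p) = (−ψ(q)q, (1 + ψ(q) + ψ'(q)q)p) on ℝ² (first component in the q-direction, second in the p-direction). Then: (a) 1 + ψ(q) + ψ'(q)q > 0 for all q ∈ ℝ; (b) Z(q, p) = 0 if and only if p = 0 and q ≥ 0; (c) the derivative of φ along Z satisfies dφ_{(q,p)}(Z(q,p)) = ψ(q)²q² + 2(1 + ψ(q) + ψ'(q)q)p² ≥ 0 for all (q, p), with equality if and only if Z(q, p) = 0. -/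
/-- A continuous function with negative derivative on `(-ε, 0)` that equals `1` to the left of
this interval and vanishes at `0` is positive on the negative half-line. -/
theorem cutoff_pos_of_neg {ε : ℝ} {ψ : ℝ → ℝ} (hψ : Continuous ψ) (hψ0 : ψ 0 = 0)
    (hψ1 : ∀ q : ℝ, q ≤ -ε → ψ q = 1)
    (hderiv : ∀ q : ℝ, -ε < q → q < 0 → deriv ψ q < 0) {q : ℝ} (hq : q < 0) : 0 < ψ q := by
  rcases le_or_gt q (-ε) with h | h
  · simp [hψ1 q h]
  · have hanti : StrictAntiOn ψ (Set.Icc q 0) := by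
      apply strictAntiOn_of_deriv_neg (convex_Icc q 0) hψ.continuousOn
      intro x hx
      rw [interior_Icc] at hx
      exact hderiv x (h.trans hx.1) hx.2
    simpa [hψ0] using hanti (Set.left_mem_Icc.2 hq.le) (Set.right_mem_Icc.2 hq.le) hq

/-- The derivative of `p ^ 2 - ∫₀^q f` at `(q, p)`, applied to a vector. -/
theorem fderiv_sq_sub_integral_apply {f : ℝ → ℝ} (hf : Continuous f) (q p a b : ℝ) :
    fderiv ℝ (fun x : ℝ × ℝ => x.2 ^ 2 - ∫ t in (0 : ℝ)..x.1, f t) (q, p) (a, b) =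
      2 * p * b - f q * a := by
  have hint : HasFDerivAt (fun x : ℝ × ℝ => ∫ t in (0 : ℝ)..x.1, f t)
      (f q • ContinuousLinearMap.fst ℝ ℝ ℝ) (q, p) := by
    have h : HasDerivAt (fun y : ℝ => ∫ t in (0 : ℝ)..y, f t) (f q) q :=
      (hf.integral_hasStrictDerivAt 0 q).hasDerivAt
    exact HasDerivAt.comp_hasFDerivAt (f := Prod.fst) (q, p) h hasFDerivAt_fst
  have hsq : HasFDerivAt (fun x : ℝ × ℝ => x.2 ^ 2)
      ((2 * p) • ContinuousLinearMap.snd ℝ ℝ ℝ) (q, p) := by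
    have h : HasDerivAt (fun y : ℝ => y ^ 2) (2 * p) p := by simpa using hasDerivAt_pow 2 p
    exact HasDerivAt.comp_hasFDerivAt (f := Prod.snd) (q, p) h hasFDerivAt_snd
  rw [(hsq.fun_sub hint).fderiv]
  simp

/-- Let ε > 0 and ψ : ℝ → ℝ a smooth function with ψ = 0 on [0,∞), ψ = 1 on
(−∞,−ε], and ψ < 1, ψ' < 0 on (−ε,0). Let h(q) = ∫₀^q ψ(t)·t dt, φ(q,p) = p² − h(q)
and Z(q,p) = (−ψ(q)q, (1 + ψ(q) + ψ'(q)q)p). Then: (a) 1 + ψ(q) + ψ'(q)q > 0 for all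
q; (b) Z(q,p) = 0 iff p = 0 and q ≥ 0; (c) the derivative of φ along Z satisfies
dφ_{(q,p)}(Z(q,p)) = ψ(q)²q² + 2(1 + ψ(q) + ψ'(q)q)p² ≥ 0, with equality iff
Z(q,p) = 0. -/
theorem morse_bott_boundary_normal_form_lyapunov
    (ε : ℝ) (hε : 0 < ε) (ψ : ℝ → ℝ) (hψ : ContDiff ℝ (⊤ : ℕ∞) ψ)
    (hψ0 : ∀ q : ℝ, 0 ≤ q → ψ q = 0)
    (hψ1 : ∀ q : ℝ, q ≤ -ε → ψ q = 1)
    (hψmid : ∀ q : ℝ, -ε < q → q < 0 → ψ q < 1 ∧ deriv ψ q < 0) :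
    (∀ q : ℝ, 0 < 1 + ψ q + deriv ψ q * q) ∧
    (∀ q p : ℝ,
      ((-(ψ q * q), (1 + ψ q + deriv ψ q * q) * p) = ((0 : ℝ), (0 : ℝ)) ↔
        p = 0 ∧ 0 ≤ q)) ∧
    (∀ q p : ℝ,
      fderiv ℝ (fun x : ℝ × ℝ => x.2 ^ 2 - ∫ t in (0 : ℝ)..x.1, ψ t * t) (q, p)
          (-(ψ q * q), (1 + ψ q + deriv ψ q * q) * p) =
        ψ q ^ 2 * q ^ 2 + 2 * (1 + ψ q + deriv ψ q * q) * p ^ 2 ∧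
      0 ≤ ψ q ^ 2 * q ^ 2 + 2 * (1 + ψ q + deriv ψ q * q) * p ^ 2 ∧
      (ψ q ^ 2 * q ^ 2 + 2 * (1 + ψ q + deriv ψ q * q) * p ^ 2 = 0 ↔
        (-(ψ q * q), (1 + ψ q + deriv ψ q * q) * p) = ((0 : ℝ), (0 : ℝ)))) := by
  have hpos : ∀ q : ℝ, q < 0 → 0 < ψ q := fun q hq =>
    cutoff_pos_of_neg hψ.continuous (hψ0 0 le_rfl) hψ1 (fun x h₁ h₂ => (hψmid x h₁ h₂).2) hq
  have hnonneg : ∀ q : ℝ, 0 ≤ ψ q := fun q =>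
    (lt_or_ge q 0).elim (fun h => (hpos q h).le) fun h => (hψ0 q h).ge
  have hle : ∀ q : ℝ, ψ q ≤ 1 := by
    intro q
    rcases le_or_gt q (-ε) with h | h
    · exact (hψ1 q h).le
    · rcases lt_or_ge q 0 with h' | h'
      · exact (hψmid q h h').1.le
      · simp [hψ0 q h']
  have hderiv : ∀ q : ℝ, 0 ≤ deriv ψ q * q := by
    intro q
    rcases le_or_gt q (-ε) with h | h
    · have hmax : IsLocalMax ψ q := .of_forall fun x => (hle x).trans (hψ1 q h).ge
      simp [hmax.deriv_eq_zero]
    · rcases lt_or_ge q 0 with h' | h'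
      · exact mul_nonneg_of_nonpos_of_nonpos (hψmid q h h').2.le h'.le
      · have hmin : IsLocalMin ψ q := .of_forall fun x => (hψ0 q h').le.trans (hnonneg x)
        simp [hmin.deriv_eq_zero]
  have ha : ∀ q : ℝ, 0 < 1 + ψ q + deriv ψ q * q := fun q => by
    linarith [hnonneg q, hderiv q]
  have hψq : ∀ q : ℝ, ψ q * q = 0 ↔ 0 ≤ q := by
    intro q
    refine ⟨fun h => ?_, fun h => by simp [hψ0 q h]⟩
    by_contra! hq
    exact (mul_neg_of_pos_of_neg (hpos q hq) hq).ne h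
  refine ⟨ha, fun q p => ?_, fun q p => ⟨?_, ?_, ?_⟩⟩
  · rw [Prod.mk.injEq, neg_eq_zero, hψq, mul_eq_zero_iff_left (ha q).ne', and_comm]
  · rw [fderiv_sq_sub_integral_apply (f := fun t => ψ t * t) (hψ.continuous.mul continuous_id)]
    ring
  · have := ha q
    positivity
  · have h := ha q
    rw [add_eq_zero_iff_of_nonneg (by positivity) (by positivity), Prod.mk.injEq, neg_eq_zero,
      ← mul_pow, pow_eq_zero_iff two_ne_zero, mul_eq_zero_iff_left (ha q).ne',
      mul_eq_zero_iff_left (mul_pos two_pos h).ne', pow_eq_zero_iff two_ne_zero]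
end
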